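/- Let n ≥ 2, m ≥ 1, 0 < α < mn, 1 < s ≤ ∞, and let Ω⃗ = (Ω_1,…,Ω_m) ∈ L^s(S^{n−1}). Let s' < p_1,…,p_m < ∞ satisfy 1/p = 1/p_1 + ⋯ + 1/p_m with s'/m < p < n/α, let 0 < κ < 1 − αp/n, and define q by 1/q = 1/p − α/(n(1−κ)). Then there exists a constant C > 0, independent of f⃗, such that for all measurable f_i with ‖f_i‖_{L^{p_i,κ}} < ∞ (i = 1,…,m), ‖T_{Ω,α;m}(f⃗)‖_{L^{q,κ}} ≤ C ∏_{i=1}^m ‖f_i‖_{L^{p_i,κ}}. -/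

import Mathlib

open MeasureTheory Metric ENNReal

noncomputable section

/-- Euclidean space `ℝⁿ`. -/
abbrev Euc (n : ℕ) := EuclideanSpace ℝ (Fin n)

/-- `Ω` is homogeneous of degree zero. -/
def HomogZero {n : ℕ} (Ω : Euc n → ℝ) : Prop :=
  ∀ ⦃l : ℝ⦄, 0 < l → ∀ x, Ω (l • x) = Ω x

/-- The `L^s` norm of `Ω` on the unit sphere `S^{n-1}`, where the surface measure
`volume.toSphere` is normalized so that the polar coordinate formula
`∫_{ℝⁿ} g(y) dy = ∫_0^∞ ∫_{S^{n-1}} g(ρθ) ρ^{n-1} dσ(θ) dρ` holds. -/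
noncomputable def sphereLpNorm (n : ℕ) (s : ℝ≥0∞) (Ω : Euc n → ℝ) : ℝ≥0∞ :=
  eLpNorm (fun θ : sphere (0 : Euc n) 1 => Ω θ.1) s ((volume : Measure (Euc n)).toSphere)

/-- `Ω ∈ L^s(S^{n-1})`: measurable, homogeneous of degree zero, finite sphere `L^s` norm. -/
def MemSphereLp (n : ℕ) (s : ℝ≥0∞) (Ω : Euc n → ℝ) : Prop :=
  Measurable Ω ∧ HomogZero Ω ∧ sphereLpNorm n s Ω < ⊤

/-- The conjugate exponent `s' = s/(s-1)` (with `s' = 1` for `s = ∞`). -/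
noncomputable def conjExp (s : ℝ≥0∞) : ℝ := if s = ⊤ then 1 else s.toReal / (s.toReal - 1)

/-- The multilinear fractional integral operator with homogeneous kernels,
`T_{Ω,α;m}(f⃗)(x) = ∫_{(ℝⁿ)^m} ∏ᵢ Ωᵢ(x-yᵢ) fᵢ(yᵢ) / ‖(x-y₁,…,x-y_m)‖^{mn-α} dy⃗`. -/
noncomputable def multiT {n : ℕ} (m : ℕ) (α : ℝ) (Ω f : Fin m → Euc n → ℝ) (x : Euc n) : ℝ :=
  ∫ y : Fin m → Euc n,
    (∏ i, Ω i (x - y i) * f i (y i)) /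
      (Real.sqrt (∑ j, ‖x - y j‖ ^ 2)) ^ ((m * n : ℝ) - α)

/-- The multilinear maximal operator `𝓜(f⃗)(x)`, with values in `[0,∞]`. -/
noncomputable def multiM {n : ℕ} (m : ℕ) (f : Fin m → Euc n → ℝ) (x : Euc n) : ℝ≥0∞ :=
  ⨆ r : Set.Ioi (0 : ℝ),
    ∏ i, (volume (ball x (r : ℝ)))⁻¹ * ∫⁻ y in ball x (r : ℝ), ENNReal.ofReal |f i y|

/-- `𝓜_t(f⃗)(x) = 𝓜(|f₁|^t,…,|f_m|^t)(x)^{1/t}`, with values in `[0,∞]`. -/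
noncomputable def multiMt {n : ℕ} (m : ℕ) (t : ℝ) (f : Fin m → Euc n → ℝ) (x : Euc n) : ℝ≥0∞ :=
  (multiM m (fun i y => |f i y| ^ t) x) ^ (1 / t)

/-- The multilinear fractional maximal operator with homogeneous kernels,
`M_{Ω,α;m}(f⃗)(x) = sup_{r>0} ∏ᵢ m(B(x,r))^{α/(mn)-1} ∫_{|x-yᵢ|<r} |Ωᵢ(x-yᵢ) fᵢ(yᵢ)| dyᵢ`,
with values in `[0,∞]`. -/
noncomputable def multiMF {n : ℕ} (m : ℕ) (α : ℝ) (Ω f : Fin m → Euc n → ℝ) (x : Euc n) :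
    ℝ≥0∞ :=
  ⨆ r : Set.Ioi (0 : ℝ),
    ∏ i, (volume (ball x (r : ℝ))) ^ (α / (m * n : ℝ) - 1) *
      ∫⁻ y in ball x (r : ℝ), ENNReal.ofReal |Ω i (x - y) * f i y|

/-- Morrey norm of a `[0,∞]`-valued function:
`sup_B (m(B)^{-κ} ∫_B F^p)^{1/p}`, the supremum over all balls `B ⊆ ℝⁿ`. -/
noncomputable def morreyNormE {n : ℕ} (p κ : ℝ) (F : Euc n → ℝ≥0∞) : ℝ≥0∞ :=
  ⨆ (z : Euc n) (r : Set.Ioi (0 : ℝ)),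
    (volume (ball z (r : ℝ)) ^ (-κ) * ∫⁻ y in ball z (r : ℝ), F y ^ p) ^ (1 / p)

/-- Morrey norm `‖f‖_{L^{p,κ}}`. -/
noncomputable def morreyNorm {n : ℕ} (p κ : ℝ) (f : Euc n → ℝ) : ℝ≥0∞ :=
  morreyNormE p κ (fun x => ENNReal.ofReal |f x|)

/-- Weak Morrey norm of a `[0,∞]`-valued function:
`sup_B sup_{l>0} m(B)^{-κ/p} · l · m({y ∈ B : F y > l})^{1/p}`. -/
noncomputable def weakMorreyNormE {n : ℕ} (p κ : ℝ) (F : Euc n → ℝ≥0∞) : ℝ≥0∞ :=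
  ⨆ (z : Euc n) (r : Set.Ioi (0 : ℝ)) (l : Set.Ioi (0 : ℝ)),
    volume (ball z (r : ℝ)) ^ (-(κ / p)) * ENNReal.ofReal (l : ℝ) *
      (volume {y | y ∈ ball z (r : ℝ) ∧ ENNReal.ofReal (l : ℝ) < F y}) ^ (1 / p)

/-- Weak Morrey norm `‖f‖_{WL^{p,κ}}`. -/
noncomputable def weakMorreyNorm {n : ℕ} (p κ : ℝ) (f : Euc n → ℝ) : ℝ≥0∞ :=
  weakMorreyNormE p κ (fun x => ENNReal.ofReal |f x|)

/-- Luxemburg norm `‖f‖_{L^p log L(B)}`. -/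
noncomputable def luxNorm {n : ℕ} (p : ℝ) (B : Set (Euc n)) (f : Euc n → ℝ) : ℝ :=
  sInf {l : ℝ | 0 < l ∧
    ∫⁻ x in B, ENNReal.ofReal ((|f x| / l) ^ p * (1 + max (Real.log (|f x| / l)) 0)) ≤ 1}

/-- `‖f‖_{(L log L)^{p,κ}} = sup_B m(B)^{-κ/p} ‖f‖_{L^p log L(B)}`. -/
noncomputable def logMorreyNorm {n : ℕ} (p κ : ℝ) (f : Euc n → ℝ) : ℝ≥0∞ :=
  ⨆ (z : Euc n) (r : Set.Ioi (0 : ℝ)),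
    volume (ball z (r : ℝ)) ^ (-(κ / p)) *
      ENNReal.ofReal (luxNorm p (ball z (r : ℝ)) f)

/-- Weak `L^p` norm `‖f‖_{L^{p,∞}} = sup_{l>0} l · m({|f| > l})^{1/p}`. -/
noncomputable def weakLpNorm {n : ℕ} (p : ℝ) (f : Euc n → ℝ) : ℝ≥0∞ :=
  ⨆ l : Set.Ioi (0 : ℝ),
    ENNReal.ofReal (l : ℝ) * (volume {x | (l : ℝ) < |f x|}) ^ (1 / p)

section Auxiliary

lemma two_rpow_add (x y : ℝ) : (2 : ℝ≥0∞) ^ (x + y) = 2 ^ x * 2 ^ y :=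
  ENNReal.rpow_add _ _ (by norm_num) (by norm_num)

lemma two_rpow_ne_top (x : ℝ) : (2 : ℝ≥0∞) ^ x ≠ ⊤ :=
  ENNReal.rpow_ne_top_of_ne_zero (by norm_num) (by norm_num)

lemma two_rpow_ne_zero (x : ℝ) : (2 : ℝ≥0∞) ^ x ≠ 0 := by
  simp [ENNReal.rpow_eq_zero_iff]

/-- The two-sided geometric series of ratio `2 ^ (-δ)`. -/
def geomSum (δ : ℝ) : ℝ≥0∞ := ∑' l : ℤ, (2 : ℝ≥0∞) ^ (-(δ * |(l : ℝ)|))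

lemma geomSum_ne_top {δ : ℝ} (hδ : 0 < δ) : geomSum δ ≠ ⊤ := by
  have h2 : (2 : ℝ) ^ (-δ) < 1 := Real.rpow_lt_one_of_one_lt_of_neg (by norm_num) (by linarith)
  have hs : Summable fun l : ℤ => (2 : ℝ) ^ (-(δ * |(l : ℝ)|)) := by
    have hg := summable_geometric_of_lt_one (by positivity) h2
    refine Summable.of_nat_of_neg (hg.congr fun k => ?_) (hg.congr fun k => ?_) <;>
    · rw [← Real.rpow_natCast, ← Real.rpow_mul (by norm_num)]
      simp
  have := hs.tsum_ofReal_ne_top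
  refine (lt_of_eq_of_lt ?_ this.lt_top).ne
  unfold geomSum
  congr 1; ext l
  rw [← ENNReal.ofReal_rpow_of_pos (by norm_num)]
  simp

lemma one_le_geomSum (δ : ℝ) : 1 ≤ geomSum δ := by
  unfold geomSum
  refine le_trans ?_ (ENNReal.le_tsum 0)
  simp

lemma tsum_le_geomSum {δ : ℝ} (j : ℤ) (A : ℝ≥0∞) (b : ℤ → ℝ≥0∞)
    (hb : ∀ k, b k ≤ A * 2 ^ (-(δ * |((k - j : ℤ) : ℝ)|))) : ∑' k, b k ≤ A * geomSum δ := by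
  refine (ENNReal.tsum_le_tsum hb).trans ?_
  rw [ENNReal.tsum_mul_left]
  refine le_of_eq ?_
  congr 1
  exact (Equiv.subRight j).tsum_eq fun l : ℤ => (2 : ℝ≥0∞) ^ (-(δ * |(l : ℝ)|))

/-- Optimising a two-sided geometric bound in the cut-off. -/
lemma tsum_le_of_two_bounds {α γ : ℝ} (hα : 0 < α) (hγ : α < γ) {a : ℤ → ℝ≥0∞} {M F : ℝ≥0∞}
    (hF : F ≠ ⊤) (h1 : ∀ k, a k ≤ M) (h2 : ∀ k : ℤ, a k ≤ 2 ^ (-(k * γ)) * F) :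
    ∑' k : ℤ, 2 ^ (k * α) * a k ≤
      2 ^ γ * geomSum (min α (γ - α)) * (M ^ (1 - α / γ) * F ^ (α / γ)) := by
  have hγ0 : 0 < γ := hα.trans hγ
  have hθ1 : α / γ < 1 := (div_lt_one hγ0).2 hγ
  have hθ0 : 0 < α / γ := by positivity
  rcases eq_or_ne M 0 with rfl | hM0
  · have : ∀ k, a k = 0 := fun k => le_antisymm (h1 k) zero_le
    simp [this]
  rcases eq_or_ne F 0 with rfl | hF0
  · have : ∀ k, a k = 0 := fun k => le_antisymm (by simpa using h2 k) zero_le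
    simp [this]
  have hG := one_le_geomSum (min α (γ - α))
  rcases eq_or_ne M ⊤ with rfl | hMt
  · have e1 : (⊤ : ℝ≥0∞) ^ (1 - α / γ) = ⊤ := ENNReal.top_rpow_of_pos (by linarith)
    have e2 : F ^ (α / γ) ≠ 0 := by
      simp [ENNReal.rpow_eq_zero_iff, hF0, hF]
    rw [e1, ENNReal.top_mul e2, ENNReal.mul_top]
    · exact le_top
    · exact mul_ne_zero (two_rpow_ne_zero _) (one_pos.trans_le hG).ne'
  obtain ⟨j, hj1, hj2⟩ := ENNReal.exists_mem_Ico_zpow (x := F / M) (y := 2 ^ γ)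
    (ENNReal.div_ne_zero.2 ⟨hF0, hMt⟩) (ENNReal.div_ne_top hF hM0)
    (ENNReal.one_lt_rpow (by norm_num) hγ0) (two_rpow_ne_top _)
  rw [← ENNReal.rpow_intCast, ← ENNReal.rpow_mul] at hj1 hj2
  push_cast at hj2
  have hj1' : (2 : ℝ≥0∞) ^ (j * α) * M ≤ M ^ (1 - α / γ) * F ^ (α / γ) := by
    have : (2 : ℝ≥0∞) ^ (j * α) ≤ (F / M) ^ (α / γ) := by
      refine le_trans (le_of_eq ?_) (ENNReal.rpow_le_rpow hj1 hθ0.le)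
      rw [← ENNReal.rpow_mul]
      congr 1
      field_simp
    refine (mul_le_mul_left this M).trans (le_of_eq ?_)
    rw [ENNReal.div_rpow_of_nonneg _ _ hθ0.le, ENNReal.rpow_sub _ _ hM0 hMt, ENNReal.rpow_one,
      div_eq_mul_inv, div_eq_mul_inv M, mul_right_comm, mul_comm _ M, mul_right_comm]
  have hj2' : F ≤ 2 ^ (γ * (j + 1)) * M :=
    (ENNReal.div_le_iff hM0 hMt).1 hj2.le
  have key : ∑' k : ℤ, 2 ^ (k * α) * a k ≤
      (2 ^ γ * (2 ^ (j * α) * M)) * geomSum (min α (γ - α)) := by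
    refine tsum_le_geomSum j _ _ fun k => ?_
    rcases le_total k j with hk | hk
    · have hk' : (k : ℝ) ≤ j := by exact_mod_cast hk
      calc 2 ^ (k * α) * a k ≤ 2 ^ (k * α) * M := by gcongr; exact h1 k
        _ ≤ 2 ^ (γ + j * α + -(min α (γ - α) * |((k - j : ℤ) : ℝ)|)) * M := by
            refine mul_le_mul_left (ENNReal.rpow_le_rpow_of_exponent_le (by norm_num) ?_) M
            push_cast
            rw [abs_of_nonpos (by linarith)]
            nlinarith [min_le_left α (γ - α)]
        _ = _ := by rw [two_rpow_add, two_rpow_add]; ring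
    · have hk' : (j : ℝ) ≤ k := by exact_mod_cast hk
      calc 2 ^ (k * α) * a k ≤ 2 ^ (k * α) * (2 ^ (-(k * γ)) * (2 ^ (γ * (j + 1)) * M)) := by
            gcongr; exact (h2 k).trans (by gcongr)
        _ = 2 ^ (k * α + -(k * γ) + γ * (j + 1)) * M := by
            rw [two_rpow_add, two_rpow_add]; ring
        _ ≤ 2 ^ (γ + j * α + -(min α (γ - α) * |((k - j : ℤ) : ℝ)|)) * M := by
            refine mul_le_mul_left (ENNReal.rpow_le_rpow_of_exponent_le (by norm_num) ?_) M
            push_cast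
            rw [abs_of_nonneg (by linarith)]
            nlinarith [min_le_right α (γ - α)]
        _ = _ := by rw [two_rpow_add, two_rpow_add]; ring
  refine key.trans ?_
  calc _ = 2 ^ γ * geomSum (min α (γ - α)) * (2 ^ (j * α) * M) := by ring
    _ ≤ _ := by gcongr

variable {n : ℕ}

/-- The average of `g` over the ball of centre `x` and radius `2 ^ k`. -/
def dyAvg (g : Euc n → ℝ≥0∞) (x : Euc n) (k : ℤ) : ℝ≥0∞ :=
  (volume (ball x ((2 : ℝ) ^ k)))⁻¹ * ∫⁻ y in ball x ((2 : ℝ) ^ k), g y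

/-- The centred Hardy–Littlewood maximal function over dyadic radii. -/
def dyMax (g : Euc n → ℝ≥0∞) (x : Euc n) : ℝ≥0∞ := ⨆ k : ℤ, dyAvg g x k

lemma volume_ball_ne_zero (x : Euc n) {r : ℝ} (hr : 0 < r) : volume (ball x r) ≠ 0 :=
  (measure_ball_pos volume x hr).ne'

lemma volume_ball_ne_top (x : Euc n) (r : ℝ) : volume (ball x r) ≠ ⊤ :=
  measure_ball_lt_top.ne

lemma two_zpow_pos (k : ℤ) : (0 : ℝ) < 2 ^ k := by positivity

lemma measurable_dyAvg {g : Euc n → ℝ≥0∞} (hg : Measurable g) (k : ℤ) :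
    Measurable fun x => dyAvg g x k := by
  unfold dyAvg
  simp_rw [Measure.addHaar_ball_center]
  refine Measurable.const_mul ?_ _
  have : ∀ x : Euc n, ∫⁻ y in ball x ((2 : ℝ) ^ k), g y =
      ∫⁻ y, Set.indicator {q : Euc n × Euc n | dist q.2 q.1 < 2 ^ k} (fun q => g q.2) (x, y) := by
    intro x
    rw [← lintegral_indicator measurableSet_ball]
    rfl
  simp_rw [this]
  refine Measurable.lintegral_prod_right' (f := Set.indicator
    {q : Euc n × Euc n | dist q.2 q.1 < 2 ^ k} (fun q => g q.2)) ?_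
  exact (hg.comp measurable_snd).indicator
    (measurableSet_lt (measurable_snd.dist measurable_fst) measurable_const)

lemma measurable_dyMax {g : Euc n → ℝ≥0∞} (hg : Measurable g) : Measurable (dyMax g) :=
  .iSup fun k => measurable_dyAvg hg k

lemma dyAvg_mono {g h : Euc n → ℝ≥0∞} (hgh : ∀ y, g y ≤ h y) (x : Euc n) (k : ℤ) :
    dyAvg g x k ≤ dyAvg h x k := by
  unfold dyAvg
  gcongr with y
  exact hgh y

lemma dyMax_le_indicator_add (g : Euc n → ℝ≥0∞) (t : ℝ≥0∞) (x : Euc n) :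
    dyMax g x ≤ dyMax ({y | t < g y}.indicator g) x + t := by
  refine iSup_le fun k => ?_
  refine le_trans ?_ (add_le_add_left (le_iSup (fun k => dyAvg ({y | t < g y}.indicator g) x k) k) t)
  refine (dyAvg_mono (h := fun y => {y | t < g y}.indicator g y + t) (fun y => ?_) x k).trans ?_
  · by_cases hy : t < g y
    · simp [Set.indicator, hy]
    · exact (not_lt.1 hy).trans le_add_self
  · unfold dyAvg
    rw [lintegral_add_right _ measurable_const, mul_add]
    gcongr
    rw [setLIntegral_const, mul_comm t, ← mul_assoc, ENNReal.inv_mul_cancel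
      (volume_ball_ne_zero x (two_zpow_pos k)) (volume_ball_ne_top x _), one_mul]

/-- Weak type `(1, 1)` bound for the dyadic-radius maximal function. -/
lemma volume_lt_dyMax_le (g : Euc n → ℝ≥0∞) {t : ℝ≥0∞} (ht : t ≠ 0) (ht' : t ≠ ⊤) :
    volume {x | t < dyMax g x} ≤ 4 ^ n * t⁻¹ * ∫⁻ y, g y := by
  have hU : {x | t < dyMax g x} = ⋃ K : ℕ, {x | ∃ k : ℤ, k ≤ K ∧ t < dyAvg g x k} := by
    ext x
    simp only [dyMax, Set.mem_ofPred_eq, lt_iSup_iff, Set.mem_iUnion]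
    constructor
    · rintro ⟨k, hk⟩
      exact ⟨k.toNat, k, Int.self_le_toNat k, hk⟩
    · rintro ⟨_, k, _, hk⟩
      exact ⟨k, hk⟩
  have hmono : Monotone fun K : ℕ => {x : Euc n | ∃ k : ℤ, k ≤ K ∧ t < dyAvg g x k} := by
    rintro K L hKL x ⟨k, hk, h⟩
    exact ⟨k, hk.trans (by exact_mod_cast hKL), h⟩
  rw [hU, hmono.measure_iUnion]
  refine iSup_le fun K => ?_
  set E := {x : Euc n | ∃ k : ℤ, k ≤ K ∧ t < dyAvg g x k} with hE
  choose! κ hκ1 hκ2 using fun (x : Euc n) (hx : x ∈ E) => hx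
  obtain ⟨u, huE, hud, hcov⟩ := Vitali.exists_disjoint_subfamily_covering_enlargement_closedBall
    E (fun x => x) (fun x => (2 : ℝ) ^ (κ x)) (2 ^ (K : ℤ))
    (fun x hx => zpow_le_zpow_right₀ (by norm_num) (hκ1 x hx)) 4 (by norm_num)
  have huc : u.Countable := hud.countable_of_nonempty_interior fun x _ =>
    ⟨x, ball_subset_interior_closedBall (mem_ball_self (two_zpow_pos _))⟩
  have hball : ∀ x ∈ u, volume (closedBall x (4 * (2 : ℝ) ^ (κ x))) ≤
      4 ^ n * t⁻¹ * ∫⁻ y in ball x ((2 : ℝ) ^ (κ x)), g y := by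
    intro x hx
    have h := (hκ2 x (huE hx)).le
    have hv0 := volume_ball_ne_zero x (two_zpow_pos (κ x))
    have hvt := volume_ball_ne_top x ((2 : ℝ) ^ (κ x))
    have e : volume (closedBall x (4 * (2 : ℝ) ^ (κ x))) =
        4 ^ n * volume (ball x ((2 : ℝ) ^ (κ x))) := by
      rw [Measure.addHaar_closedBall volume x (mul_pos (by norm_num) (two_zpow_pos _)).le,
        Measure.addHaar_ball_of_pos volume x (two_zpow_pos _), finrank_euclideanSpace_fin,
        mul_pow, ENNReal.ofReal_mul (by positivity), mul_assoc, ENNReal.ofReal_pow (by norm_num)]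
      simp
    rw [e, mul_assoc]
    gcongr
    rw [dyAvg, mul_comm, ← div_eq_mul_inv, ENNReal.le_div_iff_mul_le (.inl hv0) (.inl hvt)] at h
    rw [mul_comm, ← div_eq_mul_inv, ENNReal.le_div_iff_mul_le (.inl ht) (.inl ht'), mul_comm]
    exact h
  have hsub : E ⊆ ⋃ x ∈ u, closedBall x (4 * (2 : ℝ) ^ (κ x)) := by
    intro x hx
    obtain ⟨b, hb, hxb⟩ := hcov x hx
    exact Set.mem_biUnion hb (hxb (mem_closedBall_self (two_zpow_pos _).le))
  calc volume E ≤ ∑' x : u, volume (closedBall (x : Euc n) (4 * (2 : ℝ) ^ (κ x))) :=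
        (measure_mono hsub).trans (measure_biUnion_le _ huc _)
    _ ≤ ∑' x : u, 4 ^ n * t⁻¹ * ∫⁻ y in ball (x : Euc n) ((2 : ℝ) ^ (κ x)), g y :=
        ENNReal.tsum_le_tsum fun x => hball x x.2
    _ = 4 ^ n * t⁻¹ * ∫⁻ y in ⋃ x ∈ u, ball (x : Euc n) ((2 : ℝ) ^ (κ x)), g y := by
        rw [ENNReal.tsum_mul_left, lintegral_biUnion huc (fun _ _ => measurableSet_ball)]
        exact hud.mono_on fun x _ => ball_subset_closedBall
    _ ≤ _ := by gcongr; exact Measure.restrict_le_self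

lemma rpow_le_tsum_indicator {a : ℝ} (ha : 0 < a) (D : ℝ≥0∞) :
    D ^ a ≤ ∑' j : ℤ, Set.indicator {j : ℤ | (2 : ℝ≥0∞) ^ (j : ℝ) < D}
      (fun j => (2 : ℝ≥0∞) ^ ((j + 1) * a)) j := by
  rcases eq_or_ne D 0 with rfl | h0
  · simp [ENNReal.zero_rpow_of_pos ha]
  rcases eq_or_ne D ⊤ with rfl | ht
  · refine le_of_le_of_eq le_top (top_le_iff.1 ?_).symm
    refine le_trans ?_ (ENNReal.tsum_comp_le_tsum_of_injective (f := fun j : ℕ => (j : ℤ))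
      Nat.cast_injective _)
    have h1 : (⊤ : ℝ≥0∞) = ∑' _ : ℕ, 1 := (ENNReal.tsum_const_eq_top_of_ne_zero one_ne_zero).symm
    refine h1.trans_le ?_
    refine ENNReal.tsum_le_tsum fun j => ?_
    have hj : (j : ℤ) ∈ {j : ℤ | (2 : ℝ≥0∞) ^ (j : ℝ) < ⊤} := (two_rpow_ne_top _).lt_top
    rw [Set.indicator_of_mem hj]
    exact ENNReal.one_le_rpow (by norm_num) (by push_cast; positivity)
  · obtain ⟨j, hj1, hj2⟩ := ENNReal.exists_mem_Ioc_zpow h0 ht (y := 2) (by norm_num) (by norm_num)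
    rw [← ENNReal.rpow_intCast] at hj1 hj2
    refine le_trans ?_ (ENNReal.le_tsum j)
    rw [Set.indicator_of_mem (by simpa using hj1), ENNReal.rpow_mul]
    push_cast at hj2
    gcongr

lemma tsum_indicator_le_rpow {a : ℝ} (ha : 1 < a) (D : ℝ≥0∞) :
    ∑' j : ℤ, Set.indicator {j : ℤ | (2 : ℝ≥0∞) ^ ((j : ℝ) - 1) < D}
      (fun j => (2 : ℝ≥0∞) ^ ((j + 1) * a) * 2 ^ (-((j : ℝ) - 1))) j ≤
      2 ^ (2 * a) * geomSum (a - 1) * D ^ (a - 1) := by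
  rcases eq_or_ne D 0 with rfl | h0
  · simp
  rcases eq_or_ne D ⊤ with rfl | ht
  · rw [ENNReal.top_rpow_of_pos (by linarith), ENNReal.mul_top]
    · exact le_top
    · exact mul_ne_zero (two_rpow_ne_zero _) (one_pos.trans_le (one_le_geomSum _)).ne'
  · obtain ⟨J, hj1, hj2⟩ := ENNReal.exists_mem_Ioc_zpow h0 ht (y := 2) (by norm_num) (by norm_num)
    rw [← ENNReal.rpow_intCast] at hj1 hj2
    refine (tsum_le_geomSum (δ := a - 1) (J + 1) (2 ^ (2 * a) * 2 ^ ((a - 1) * J)) _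
      fun j => ?_).trans ?_
    · refine Set.indicator_apply_le' (fun hj => ?_) fun _ => zero_le
      have hj' : (j : ℝ) - 1 < (J : ℝ) + 1 := by
        by_contra! hcon
        push_cast at hj2
        exact absurd (hj.trans_le hj2) (not_lt.2 (ENNReal.rpow_le_rpow_of_exponent_le (by norm_num) hcon))
      have hj'' : j ≤ J + 1 := by
        have : ((j - 1 : ℤ) : ℝ) < ((J + 1 : ℤ) : ℝ) := by push_cast; exact hj'
        have := Int.cast_lt.1 this
        omega
      have hj3 : (j : ℝ) ≤ J + 1 := by exact_mod_cast hj''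
      rw [← two_rpow_add, ← two_rpow_add, ← two_rpow_add]
      push_cast
      rw [abs_of_nonpos (by linarith)]
      refine ENNReal.rpow_le_rpow_of_exponent_le (by norm_num) ?_
      nlinarith
    · calc _ = 2 ^ (2 * a) * geomSum (a - 1) * (2 ^ ((a - 1) * J)) := by ring
        _ ≤ _ := by
          gcongr
          rw [mul_comm, ENNReal.rpow_mul]
          exact ENNReal.rpow_le_rpow hj1.le (by linarith)

/-- The constant in the strong type bound for `dyMax`. -/
def maxConst (n : ℕ) (a : ℝ) : ℝ≥0∞ := 4 ^ n * (2 ^ (2 * a) * geomSum (a - 1))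

lemma maxConst_ne_top (n : ℕ) {a : ℝ} (ha : 1 < a) : maxConst n a ≠ ⊤ :=
  ENNReal.mul_ne_top (by finiteness)
    (ENNReal.mul_ne_top (two_rpow_ne_top _) (geomSum_ne_top (by linarith)))

/-- The Hardy–Littlewood maximal theorem on `L^a`, `a > 1`, for dyadic radii. -/
lemma lintegral_dyMax_rpow_le {a : ℝ} (ha : 1 < a) {g : Euc n → ℝ≥0∞} (hg : Measurable g) :
    ∫⁻ x, dyMax g x ^ a ≤ maxConst n a * ∫⁻ x, g x ^ a := by
  have hD := measurable_dyMax hg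
  have hmeas : ∀ t : ℝ≥0∞, MeasurableSet {y | t < g y} := fun t => measurableSet_lt measurable_const hg
  have hmeasD : ∀ t : ℝ≥0∞, MeasurableSet {y | t < dyMax g y} :=
    fun t => measurableSet_lt measurable_const hD
  have hlevel : ∀ j : ℤ, volume {x | (2 : ℝ≥0∞) ^ (j : ℝ) < dyMax g x} ≤
      4 ^ n * 2 ^ (-((j : ℝ) - 1)) *
        ∫⁻ y, {y | (2 : ℝ≥0∞) ^ ((j : ℝ) - 1) < g y}.indicator g y := by
    intro j
    rw [ENNReal.rpow_neg]
    refine le_trans (measure_mono fun x hx => ?_)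
      (volume_lt_dyMax_le _ (two_rpow_ne_zero _) (two_rpow_ne_top _))
    have hx : (2 : ℝ≥0∞) ^ (j : ℝ) < dyMax g x := hx
    have h2 := hx.trans_le (dyMax_le_indicator_add g ((2 : ℝ≥0∞) ^ ((j : ℝ) - 1)) x)
    have e : (2 : ℝ≥0∞) ^ (j : ℝ) = 2 ^ ((j : ℝ) - 1) + 2 ^ ((j : ℝ) - 1) := by
      rw [← two_mul]
      nth_rewrite 2 [← ENNReal.rpow_one 2]
      rw [← two_rpow_add]
      ring_nf
    rw [e] at h2
    exact lt_of_add_lt_add_right h2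
  calc ∫⁻ x, dyMax g x ^ a
      ≤ ∫⁻ x, ∑' j : ℤ, {x | (2 : ℝ≥0∞) ^ (j : ℝ) < dyMax g x}.indicator
          (fun _ => (2 : ℝ≥0∞) ^ (((j : ℝ) + 1) * a)) x :=
        lintegral_mono fun x => rpow_le_tsum_indicator (by linarith) _
    _ = ∑' j : ℤ, 2 ^ (((j : ℝ) + 1) * a) * volume {x | (2 : ℝ≥0∞) ^ (j : ℝ) < dyMax g x} := by
        rw [lintegral_tsum fun j => (measurable_const.indicator (hmeasD _)).aemeasurable]
        congr 1; ext j
        rw [lintegral_indicator_const (hmeasD _)]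
    _ ≤ ∑' j : ℤ, 2 ^ (((j : ℝ) + 1) * a) * (4 ^ n * 2 ^ (-((j : ℝ) - 1)) *
        ∫⁻ y, {y | (2 : ℝ≥0∞) ^ ((j : ℝ) - 1) < g y}.indicator g y) := by
        gcongr with j; exact hlevel j
    _ = ∑' j : ℤ, ∫⁻ y, 4 ^ n * (2 ^ (((j : ℝ) + 1) * a) * 2 ^ (-((j : ℝ) - 1)) *
        {y | (2 : ℝ≥0∞) ^ ((j : ℝ) - 1) < g y}.indicator g y) := by
        congr 1; ext j
        rw [lintegral_const_mul _ ((hg.indicator (hmeas _)).const_mul _),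
          lintegral_const_mul _ (hg.indicator (hmeas _))]
        ring
    _ = ∫⁻ y, ∑' j : ℤ, 4 ^ n * (2 ^ (((j : ℝ) + 1) * a) * 2 ^ (-((j : ℝ) - 1)) *
        {y | (2 : ℝ≥0∞) ^ ((j : ℝ) - 1) < g y}.indicator g y) := by
        rw [lintegral_tsum fun j =>
          (((hg.indicator (hmeas _)).const_mul _).const_mul _).aemeasurable]
    _ ≤ ∫⁻ y, maxConst n a * g y ^ a := by
        refine lintegral_mono fun y => ?_
        rw [ENNReal.tsum_mul_left]
        have e : g y ^ a = g y ^ (a - 1) * g y := by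
          nth_rewrite 3 [← ENNReal.rpow_one (g y)]
          rw [← ENNReal.rpow_add_of_nonneg _ _ (by linarith) zero_le_one]
          ring_nf
        rw [maxConst, mul_assoc, e, ← mul_assoc (_ * geomSum _)]
        gcongr
        refine le_trans (le_of_eq ?_) (mul_le_mul_left (tsum_indicator_le_rpow ha (g y)) (g y))
        rw [← ENNReal.tsum_mul_right]
        congr 1; ext j
        by_cases h : (2 : ℝ≥0∞) ^ ((j : ℝ) - 1) < g y <;> simp [Set.indicator, h]
    _ = _ := by rw [lintegral_const_mul _ (hg.pow_const a)]

lemma dyAvg_rpow_le {s p : ℝ} (hs : 0 < s) (hsp : s ≤ p) {g : Euc n → ℝ≥0∞} (hg : Measurable g)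
    (x : Euc n) (k : ℤ) :
    dyAvg (fun y => g y ^ s) x k ^ (1 / s) ≤ dyAvg (fun y => g y ^ p) x k ^ (1 / p) := by
  have hv0 := volume_ball_ne_zero x (two_zpow_pos k)
  have hvt := volume_ball_ne_top x ((2 : ℝ) ^ k)
  set μ := (volume (ball x ((2 : ℝ) ^ k)))⁻¹ • volume.restrict (ball x ((2 : ℝ) ^ k)) with hμ
  have : IsProbabilityMeasure μ := ⟨by simp [hμ, ENNReal.inv_mul_cancel hv0 hvt]⟩
  have h := eLpNorm'_le_eLpNorm'_of_exponent_le hs hsp μ hg.aestronglyMeasurable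
  simpa [eLpNorm', hμ, dyAvg, lintegral_smul_measure] using h

lemma dyAvg_le_rpow {a κ : ℝ} {h : Euc n → ℝ≥0∞} {N : ℝ≥0∞}
    (hN : ∀ (z : Euc n) (r : ℝ), 0 < r → ∫⁻ y in ball z r, h y ^ a ≤ volume (ball z r) ^ κ * N)
    (x : Euc n) (k : ℤ) :
    dyAvg (fun y => h y ^ a) x k ≤ volume (ball x ((2 : ℝ) ^ k)) ^ (κ - 1) * N := by
  have hv0 := volume_ball_ne_zero x (two_zpow_pos k)
  have hvt := volume_ball_ne_top x ((2 : ℝ) ^ k)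
  unfold dyAvg
  rw [sub_eq_neg_add, ENNReal.rpow_add _ _ hv0 hvt, ENNReal.rpow_neg_one, mul_assoc]
  gcongr
  exact hN x _ (two_zpow_pos k)

/-- The maximal function is bounded on Morrey spaces. -/
lemma lintegral_ball_dyMax_rpow_le {a κ : ℝ} (ha : 1 < a) (hκ : κ ≤ 1)
    {h : Euc n → ℝ≥0∞} (hh : Measurable h) {N : ℝ≥0∞}
    (hN : ∀ (z : Euc n) (r : ℝ), 0 < r → ∫⁻ y in ball z r, h y ^ a ≤ volume (ball z r) ^ κ * N)
    (z : Euc n) {r : ℝ} (hr : 0 < r) :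
    ∫⁻ x in ball z r, dyMax h x ^ a ≤
      (maxConst n a * (2 ^ n) ^ κ + 1) * (volume (ball z r) ^ κ * N) := by
  have ha0 : 0 < a := by linarith
  have hv0 := volume_ball_ne_zero z hr
  have hvt := volume_ball_ne_top z r
  set V := volume (ball z r) with hV
  set h₁ := (ball z (2 * r)).indicator h with hh₁
  have hpt : ∀ x ∈ ball z r, dyMax h x ^ a ≤ dyMax h₁ x ^ a + V ^ (κ - 1) * N := by
    intro x hx
    have : dyMax h x ≤ max (dyMax h₁ x) ((V ^ (κ - 1) * N) ^ (1 / a)) := by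
      refine iSup_le fun k => ?_
      rcases le_or_gt ((2 : ℝ) ^ k) r with hk | hk
      · refine le_max_of_le_left (le_trans (le_of_eq ?_) (le_iSup (dyAvg h₁ x) k))
        unfold dyAvg
        congr 1
        refine setLIntegral_congr_fun measurableSet_ball fun y hy => ?_
        have : y ∈ ball z (2 * r) := by
          rw [mem_ball] at *
          linarith [dist_triangle y x z]
        rw [hh₁, Set.indicator_of_mem this]
      · refine le_max_of_le_right ?_
        have h1 := dyAvg_rpow_le one_pos ha.le hh x k
        simp only [ENNReal.rpow_one, div_one] at h1
        refine h1.trans (ENNReal.rpow_le_rpow ((dyAvg_le_rpow hN x k).trans ?_) (by positivity))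
        refine mul_le_mul_left ?_ N
        rw [← neg_sub 1 κ, ENNReal.rpow_neg, ENNReal.rpow_neg, ENNReal.inv_le_inv]
        refine ENNReal.rpow_le_rpow ?_ (by linarith)
        rw [hV, Measure.addHaar_ball_center, Measure.addHaar_ball_center volume x]
        exact measure_mono (ball_subset_ball hk.le)
    refine (ENNReal.rpow_le_rpow this ha0.le).trans ?_
    rw [(ENNReal.monotone_rpow_of_nonneg ha0.le).map_max, ← ENNReal.rpow_mul,
      one_div_mul_cancel ha0.ne', ENNReal.rpow_one]
    exact max_le le_self_add le_add_self
  have hV2 : volume (ball z (2 * r)) = 2 ^ n * V := by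
    rw [hV, Measure.addHaar_ball_of_pos volume z (by positivity),
      Measure.addHaar_ball_of_pos volume z hr, finrank_euclideanSpace_fin,
        mul_pow, ENNReal.ofReal_mul (by positivity), mul_assoc, ENNReal.ofReal_pow (by norm_num)]
    simp
  have hm₁ : Measurable h₁ := hh.indicator measurableSet_ball
  calc ∫⁻ x in ball z r, dyMax h x ^ a
      ≤ ∫⁻ x in ball z r, (dyMax h₁ x ^ a + V ^ (κ - 1) * N) :=
        setLIntegral_mono' measurableSet_ball hpt
    _ = (∫⁻ x in ball z r, dyMax h₁ x ^ a) + V ^ (κ - 1) * N * V := by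
        rw [lintegral_add_right _ measurable_const, setLIntegral_const]
    _ ≤ maxConst n a * ((2 ^ n * V) ^ κ * N) + V ^ (κ - 1) * N * V := by
        gcongr
        refine (setLIntegral_le_lintegral _ _).trans
          ((lintegral_dyMax_rpow_le ha hm₁).trans ?_)
        gcongr
        rw [← hV2]
        refine le_trans (le_of_eq ?_) (hN z (2 * r) (by positivity))
        rw [← lintegral_indicator measurableSet_ball]
        congr 1; ext y
        by_cases hy : y ∈ ball z (2 * r)
        · simp only [hh₁, Set.indicator_of_mem hy]
        · simp only [hh₁, Set.indicator_of_notMem hy, ENNReal.zero_rpow_of_pos ha0]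
    _ = _ := by
        have e : V ^ (κ - 1) * V = V ^ κ := by
          nth_rewrite 2 [← ENNReal.rpow_one V]
          rw [← ENNReal.rpow_add _ _ hv0 hvt, sub_add_cancel]
        rw [ENNReal.mul_rpow_of_ne_top (by finiteness) hvt, mul_right_comm _ N, e]
        ring

/-- The radial projection onto the sphere pushes Lebesgue measure on the unit ball to a multiple
of the surface measure. -/
lemma smul_map_normalize (hn : 0 < n) :
    (n : ℝ≥0∞) • Measure.map (fun x : Euc n => ‖x‖⁻¹ • x) (volume.restrict (ball 0 1)) =
      Measure.map (Subtype.val : sphere (0 : Euc n) 1 → Euc n)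
        ((volume : Measure (Euc n)).toSphere) := by
  have : Nonempty (Fin n) := ⟨⟨0, hn⟩⟩
  have hm : Measurable fun x : Euc n => ‖x‖⁻¹ • x := by fun_prop
  ext A hA
  rw [Measure.map_apply measurable_subtype_coe hA, Measure.smul_apply, smul_eq_mul,
    Measure.map_apply hm hA, Measure.restrict_apply (hm hA),
    Measure.toSphere_apply' _ (measurable_subtype_coe hA), finrank_euclideanSpace_fin]
  congr 1
  rw [← measure_sdiff_null (measure_singleton (0 : Euc n)) (s := _ ∩ ball 0 1)]
  congr 1
  ext x
  simp only [Set.mem_sdiff, Set.mem_inter_iff, Set.mem_preimage, Set.mem_singleton_iff,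
    mem_ball_zero_iff, Set.mem_smul, Set.mem_image, Subtype.exists, mem_sphere_zero_iff_norm]
  constructor
  · rintro ⟨⟨h1, h2⟩, h3⟩
    have hx : 0 < ‖x‖ := norm_pos_iff.2 h3
    refine ⟨‖x‖, ⟨hx, h2⟩, ‖x‖⁻¹ • x, ⟨_, ?_, h1, rfl⟩, ?_⟩
    · rw [norm_smul, norm_inv, norm_norm, inv_mul_cancel₀ hx.ne']
    · rw [smul_smul, mul_inv_cancel₀ hx.ne', one_smul]
  · rintro ⟨t, ⟨ht0, ht1⟩, _, ⟨y, hy, hyA, rfl⟩, rfl⟩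
    have e : ‖t • y‖ = t := by rw [norm_smul, hy, mul_one, Real.norm_of_nonneg ht0.le]
    refine ⟨⟨?_, by rwa [e]⟩, ?_⟩
    · rwa [e, smul_smul, inv_mul_cancel₀ ht0.ne', one_smul]
    · exact norm_pos_iff.1 (by rw [e]; exact ht0)

lemma ae_ne_zero (hn : 0 < n) : ∀ᵐ x : Euc n, x ≠ 0 := by
  have : Nonempty (Fin n) := ⟨⟨0, hn⟩⟩
  have h : volume ({0} : Set (Euc n)) = 0 := measure_singleton 0
  exact measure_eq_zero_iff_ae_notMem.1 h

lemma eLpNorm_ball_lt_top (hn : 0 < n) {s : ℝ≥0∞} {Ω : Euc n → ℝ} (hΩ : MemSphereLp n s Ω) :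
    eLpNorm Ω s (volume.restrict (ball 0 1)) < ⊤ := by
  obtain ⟨hm, hh, hfin⟩ := hΩ
  have hN : Measurable fun x : Euc n => ‖x‖⁻¹ • x := by fun_prop
  have e : eLpNorm Ω s (volume.restrict (ball 0 1)) =
      eLpNorm Ω s (Measure.map (fun x : Euc n => ‖x‖⁻¹ • x) (volume.restrict (ball 0 1))) := by
    rw [eLpNorm_map_measure hm.aestronglyMeasurable hN.aemeasurable]
    refine eLpNorm_congr_ae (ae_restrict_of_ae ?_)
    filter_upwards [ae_ne_zero hn] with x hx
    exact (hh (inv_pos.2 (norm_pos_iff.2 hx)) x).symm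
  have hle : Measure.map (fun x : Euc n => ‖x‖⁻¹ • x) (volume.restrict (ball 0 1)) ≤
      Measure.map (Subtype.val : sphere (0 : Euc n) 1 → Euc n)
        ((volume : Measure (Euc n)).toSphere) := by
    rw [← smul_map_normalize hn]
    refine Measure.le_iff.2 fun A _ => ?_
    have h1 : (1 : ℝ≥0∞) ≤ n := by exact_mod_cast hn
    rw [Measure.smul_apply, smul_eq_mul]
    exact le_mul_of_one_le_left zero_le h1
  rw [e]
  refine lt_of_le_of_lt (eLpNorm_mono_measure _ hle) ?_
  rw [eLpNorm_map_measure hm.aestronglyMeasurable measurable_subtype_coe.aemeasurable]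
  exact hfin

lemma eLpNorm_sub_ball {s : ℝ≥0∞} {Ω : Euc n → ℝ} (hm : Measurable Ω) (hh : HomogZero Ω)
    (x : Euc n) {r : ℝ} (hr : 0 < r) :
    eLpNorm (fun y => Ω (x - y)) s (volume.restrict (ball x r)) =
      ENNReal.ofReal (r ^ n) ^ (1 / s).toReal * eLpNorm Ω s (volume.restrict (ball 0 1)) := by
  set T : Euc n → Euc n := fun y => r⁻¹ • (x - y) with hT
  have hTm : Measurable T := by fun_prop
  have hmap : Measure.map T (volume.restrict (ball x r)) =
      ENNReal.ofReal (r ^ n) • volume.restrict (ball 0 1) := by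
    have hpre : T ⁻¹' ball 0 1 = ball x r := by
      ext y
      rw [Set.mem_preimage, mem_ball_zero_iff, hT, norm_smul, norm_inv,
        Real.norm_of_nonneg hr.le, mem_ball, dist_comm y x, dist_eq_norm]
      rw [inv_mul_lt_iff₀ hr, mul_one]
    rw [← hpre, ← Measure.restrict_map hTm measurableSet_ball, ← Measure.restrict_smul]
    congr 1
    have : T = (fun z => r⁻¹ • z) ∘ (fun y => x - y) := rfl
    rw [this, ← Measure.map_map (by fun_prop) (by fun_prop),
      (Measure.measurePreserving_sub_left volume x).map_eq, Measure.map_addHaar_smul _ (by positivity),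
      finrank_euclideanSpace_fin]
    congr 2
    rw [inv_pow, inv_inv, abs_of_pos (by positivity)]
  have e : (fun y => Ω (x - y)) = Ω ∘ T := by
    ext y
    exact (hh (inv_pos.2 hr) (x - y)).symm
  rw [e, ← eLpNorm_map_measure hm.aestronglyMeasurable hTm.aemeasurable, hmap,
    eLpNorm_smul_measure_of_ne_zero (by simpa using pow_pos hr n), smul_eq_mul]

lemma one_le_conjExp {s : ℝ≥0∞} (hs : 1 < s) : 1 ≤ conjExp s := by
  unfold conjExp
  split_ifs with h
  · exact le_rfl
  · have : 1 < s.toReal := by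
      rwa [← ENNReal.toReal_one, ENNReal.toReal_lt_toReal (by simp) h]
    rw [le_div_iff₀ (by linarith)]
    linarith

lemma inv_add_inv_conjExp {s : ℝ≥0∞} (hs : 1 < s) : (1 / s).toReal + 1 / conjExp s = 1 := by
  unfold conjExp
  split_ifs with h
  · simp [h]
  · have : 1 < s.toReal := by
      rwa [← ENNReal.toReal_one, ENNReal.toReal_lt_toReal (by simp) h]
    rw [ENNReal.toReal_div]
    have : s.toReal - 1 ≠ 0 := by linarith
    simp
    field_simp
    ring

lemma holderTriple_conjExp {s : ℝ≥0∞} (hs : 1 < s) :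
    ENNReal.HolderTriple s (ENNReal.ofReal (conjExp s)) 1 := by
  constructor
  have h1 := inv_add_inv_conjExp hs
  have hc := one_le_conjExp hs
  have hs0 : s⁻¹ ≠ ⊤ := by simp [(one_pos.trans hs).ne']
  rw [← ENNReal.ofReal_inv_of_pos (by linarith), ← ENNReal.ofReal_toReal hs0,
    ← ENNReal.ofReal_add (by positivity) (by positivity)]
  rw [one_div, one_div] at h1
  rw [h1, inv_one, ENNReal.ofReal_one]

/-- The constant bounding a rough average by the `L^{s'}` average. -/
def kernelConst (n : ℕ) (s : ℝ≥0∞) (Ω : Euc n → ℝ) : ℝ≥0∞ :=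
  eLpNorm Ω s (volume.restrict (ball 0 1)) * volume (ball (0 : Euc n) 1) ^ (1 / conjExp s)

lemma kernelConst_ne_top (hn : 0 < n) {s : ℝ≥0∞} (hs : 1 < s) {Ω : Euc n → ℝ}
    (hΩ : MemSphereLp n s Ω) : kernelConst n s Ω ≠ ⊤ := by
  have hc := one_le_conjExp hs
  exact ENNReal.mul_ne_top (eLpNorm_ball_lt_top hn hΩ).ne
    (ENNReal.rpow_ne_top_of_nonneg (by positivity) (volume_ball_ne_top _ _))

lemma ofReal_two_zpow_pow (k : ℤ) : ENNReal.ofReal (((2 : ℝ) ^ k) ^ n) = 2 ^ ((k : ℝ) * n) := by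
  rw [ENNReal.rpow_mul, ENNReal.rpow_intCast, ENNReal.rpow_natCast,
    ENNReal.ofReal_pow (by positivity), ← Real.rpow_intCast,
    ← ENNReal.ofReal_rpow_of_pos (by norm_num), ENNReal.rpow_intCast]
  simp

lemma lintegral_kernel_mul_le {s : ℝ≥0∞} (hs : 1 < s) {Ω : Euc n → ℝ}
    (hΩ : MemSphereLp n s Ω) {f : Euc n → ℝ} (hf : Measurable f) (x : Euc n) (k : ℤ) :
    ∫⁻ y in ball x ((2 : ℝ) ^ k), ‖Ω (x - y) * f y‖ₑ ≤
      kernelConst n s Ω * (2 ^ ((k : ℝ) * n) *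
        dyAvg (fun y => ‖f y‖ₑ ^ conjExp s) x k ^ (1 / conjExp s)) := by
  have hc := one_le_conjExp hs
  have hv0 := volume_ball_ne_zero x (two_zpow_pos k)
  have hvt := volume_ball_ne_top x ((2 : ℝ) ^ k)
  obtain ⟨hm, hh, _⟩ := hΩ
  have := holderTriple_conjExp hs
  have hφ : Measurable fun y => Ω (x - y) := by fun_prop
  have h := eLpNorm_smul_le_mul_eLpNorm (p := s) (q := ENNReal.ofReal (conjExp s)) (r := 1)
    (μ := volume.restrict (ball x ((2 : ℝ) ^ k))) hf.aestronglyMeasurable hφ.aestronglyMeasurable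
  rw [eLpNorm_one_eq_lintegral_enorm] at h
  refine h.trans (le_of_eq ?_)
  rw [eLpNorm_sub_ball hm hh x (two_zpow_pos k),
    eLpNorm_eq_lintegral_rpow_enorm_toReal (p := ENNReal.ofReal (conjExp s))
      (by simp; linarith) (by simp),
    ENNReal.toReal_ofReal (by linarith)]
  have e : ∫⁻ y in ball x ((2 : ℝ) ^ k), ‖f y‖ₑ ^ conjExp s =
      2 ^ ((k : ℝ) * n) * volume (ball (0 : Euc n) 1) * dyAvg (fun y => ‖f y‖ₑ ^ conjExp s) x k := by
    have hv := Measure.addHaar_ball_of_pos volume x (two_zpow_pos k)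
    rw [finrank_euclideanSpace_fin] at hv
    rw [dyAvg, ← mul_assoc, ← ofReal_two_zpow_pow, ← hv, ENNReal.mul_inv_cancel hv0 hvt, one_mul]
  have hc0 : 0 ≤ 1 / conjExp s := by positivity
  rw [e, ENNReal.mul_rpow_of_nonneg _ _ hc0, ENNReal.mul_rpow_of_nonneg _ _ hc0,
    ofReal_two_zpow_pow, kernelConst]
  have e2 : ((2 : ℝ≥0∞) ^ ((k : ℝ) * n)) ^ (1 / s).toReal *
      ((2 : ℝ≥0∞) ^ ((k : ℝ) * n)) ^ (1 / conjExp s) = 2 ^ ((k : ℝ) * n) := by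
    rw [← ENNReal.rpow_add _ _ (two_rpow_ne_zero _) (two_rpow_ne_top _), inv_add_inv_conjExp hs,
      ENNReal.rpow_one]
  nth_rewrite 3 [← e2]
  ring

lemma lintegral_pi_prod_eq {E : Type*} [MeasurableSpace E] (μ : Measure E) [SigmaFinite μ]
    {m : ℕ} {f : Fin m → E → ℝ≥0∞} (hf : ∀ i, Measurable (f i)) :
    ∫⁻ y : Fin m → E, ∏ i, f i (y i) ∂(Measure.pi fun _ => μ) = ∏ i, ∫⁻ y, f i y ∂μ := by
  induction m with
  | zero => simp
  | succ m ih =>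
    have hp := measurePreserving_piFinSuccAbove (fun _ : Fin (m + 1) => μ) 0
    have hg : Measurable fun y : Fin m → E => ∏ i, f (Fin.succ i) (y i) :=
      Finset.measurable_prod _ fun i _ => (hf _).comp (measurable_pi_apply i)
    rw [Fin.prod_univ_succ, ← ih fun i => hf i.succ,
      ← lintegral_prod_mul (hf 0).aemeasurable hg.aemeasurable,
      ← hp.lintegral_comp (by fun_prop)]
    refine lintegral_congr fun y => ?_
    rw [Fin.prod_univ_succ]
    rfl

lemma norm_le_sqrt_sum {m : ℕ} (z : Fin m → Euc n) (i : Fin m) :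
    ‖z i‖ ≤ √(∑ j, ‖z j‖ ^ 2) :=
  Real.le_sqrt_of_sq_le
    (Finset.single_le_sum (f := fun j => ‖z j‖ ^ 2) (fun _ _ => by positivity) (Finset.mem_univ i))

/-- Dyadic decomposition of the multilinear fractional kernel. -/
lemma enorm_prod_div_rpow_le {m : ℕ} {β : ℝ} (hβ : 0 < β) (x : Euc n) (y : Fin m → Euc n)
    (c : Fin m → ℝ) :
    ‖(∏ i, c i) / √(∑ j, ‖x - y j‖ ^ 2) ^ β‖ₑ ≤
      2 ^ β * ∑' k : ℤ, 2 ^ (-(k * β)) *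
        ∏ i, (ball x ((2 : ℝ) ^ k)).indicator (fun _ => ‖c i‖ₑ) (y i) := by
  set N := √(∑ j, ‖x - y j‖ ^ 2) with hN
  have hN0 : 0 ≤ N := Real.sqrt_nonneg _
  rcases hN0.eq_or_lt with h0 | h0
  · rw [← h0, Real.zero_rpow hβ.ne', _root_.div_zero, enorm_zero]
    exact zero_le
  obtain ⟨k, hk1, hk2⟩ := exists_mem_Ico_zpow h0 (one_lt_two)
  refine le_trans ?_ (mul_le_mul_right (ENNReal.le_tsum (k + 1)) _)
  have hy : ∀ i, y i ∈ ball x ((2 : ℝ) ^ (k + 1)) := fun i => by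
    rw [mem_ball, dist_comm, dist_eq_norm]
    exact (norm_le_sqrt_sum (fun j => x - y j) i).trans_lt hk2
  have e : ∏ i, (ball x ((2 : ℝ) ^ (k + 1))).indicator (fun _ => ‖c i‖ₑ) (y i) = ‖∏ i, c i‖ₑ := by
    simp_rw [Real.enorm_eq_ofReal_abs, Finset.abs_prod]
    rw [ENNReal.ofReal_prod_of_nonneg fun _ _ => abs_nonneg _]
    exact Finset.prod_congr rfl fun i _ => Set.indicator_of_mem (hy i) _
  have h2 : ‖(N ^ β)⁻¹‖ₑ ≤ 2 ^ (-(k * β)) := by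
    have : (2 : ℝ) ^ ((k : ℝ) * β) ≤ N ^ β := by
      rw [Real.rpow_mul zero_le_two, Real.rpow_intCast]
      exact Real.rpow_le_rpow (by positivity) hk1 hβ.le
    rw [Real.enorm_eq_ofReal (by positivity), ENNReal.ofReal_inv_of_pos (by positivity),
      ENNReal.rpow_neg, ENNReal.inv_le_inv]
    refine le_trans (le_of_eq ?_) (ENNReal.ofReal_le_ofReal this)
    rw [← ENNReal.ofReal_rpow_of_pos two_pos, ENNReal.ofReal_ofNat]
  rw [e, div_eq_mul_inv, enorm_mul, mul_comm, ← mul_assoc, ← two_rpow_add]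
  gcongr
  refine h2.trans (le_of_eq ?_)
  congr 1
  push_cast
  ring

lemma enorm_multiT_le {m : ℕ} {α : ℝ} (hα : α < m * n) {Ω f : Fin m → Euc n → ℝ}
    (hΩ : ∀ i, Measurable (Ω i)) (hf : ∀ i, Measurable (f i)) (x : Euc n) :
    ‖multiT m α Ω f x‖ₑ ≤ 2 ^ (m * n - α) * ∑' k : ℤ, 2 ^ (-(k * (m * n - α))) *
      ∏ i, ∫⁻ y in ball x ((2 : ℝ) ^ k), ‖Ω i (x - y) * f i y‖ₑ := by
  have hmeas : ∀ (k : ℤ) (i : Fin m), Measurable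
      ((ball x ((2 : ℝ) ^ k)).indicator fun y => ‖Ω i (x - y) * f i y‖ₑ) := fun k i => by
    have := hΩ i
    have := hf i
    exact Measurable.indicator (by fun_prop) measurableSet_ball
  have hprod : ∀ k : ℤ, Measurable fun y : Fin m → Euc n => ∏ i,
      (ball x ((2 : ℝ) ^ k)).indicator (fun y => ‖Ω i (x - y) * f i y‖ₑ) (y i) := fun k =>
    Finset.measurable_prod _ fun i _ => (hmeas k i).comp (measurable_pi_apply i)
  calc ‖multiT m α Ω f x‖ₑ
      ≤ ∫⁻ y : Fin m → Euc n, 2 ^ (m * n - α) * ∑' k : ℤ, 2 ^ (-(k * (m * n - α))) * ∏ i,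
        (ball x ((2 : ℝ) ^ k)).indicator (fun y => ‖Ω i (x - y) * f i y‖ₑ) (y i) :=
        (enorm_integral_le_lintegral_enorm _).trans
          (lintegral_mono fun y => enorm_prod_div_rpow_le (sub_pos.2 hα) x y _)
    _ = _ := by
        rw [lintegral_const_mul _ (Measurable.tsum fun k => (hprod k).const_mul _),
          lintegral_tsum fun k => ((hprod k).const_mul _).aemeasurable]
        congr 2
        ext k
        rw [lintegral_const_mul _ (hprod k), volume_pi, lintegral_pi_prod_eq _ (hmeas k)]
        simp_rw [lintegral_indicator measurableSet_ball]

lemma lintegral_ball_rpow_le_morreyNormE {p κ : ℝ} (hp : 0 < p) (F : Euc n → ℝ≥0∞) (z : Euc n)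
    {r : ℝ} (hr : 0 < r) :
    ∫⁻ y in ball z r, F y ^ p ≤ volume (ball z r) ^ κ * morreyNormE p κ F ^ p := by
  have hv0 := volume_ball_ne_zero z hr
  have hvt := volume_ball_ne_top z r
  have h : (volume (ball z r) ^ (-κ) * ∫⁻ y in ball z r, F y ^ p) ^ (1 / p) ≤ morreyNormE p κ F :=
    le_iSup₂_of_le z ⟨r, hr⟩ le_rfl
  rw [one_div, ENNReal.rpow_inv_le_iff hp] at h
  refine le_trans (le_of_eq ?_) (mul_le_mul_right h _)
  rw [← mul_assoc, ← ENNReal.rpow_add _ _ hv0 hvt, add_neg_cancel, ENNReal.rpow_zero, one_mul]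

lemma prod_rpow_eq_rpow_sum {ι : Type*} (t : Finset ι) {v : ℝ≥0∞} (h0 : v ≠ 0) (ht : v ≠ ⊤)
    (e : ι → ℝ) : ∏ i ∈ t, v ^ e i = v ^ ∑ i ∈ t, e i := by
  classical
  induction t using Finset.induction with
  | empty => simp
  | insert i t hi ih => rw [Finset.prod_insert hi, Finset.sum_insert hi, ENNReal.rpow_add _ _ h0 ht, ih]

lemma lintegral_ball_enorm_rpow_le {p κ : ℝ} (hp : 0 < p) (f : Euc n → ℝ) (z : Euc n)
    (r : ℝ) (hr : 0 < r) :
    ∫⁻ y in ball z r, ‖f y‖ₑ ^ p ≤ volume (ball z r) ^ κ * morreyNorm p κ f ^ p := by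
  simp_rw [Real.enorm_eq_ofReal_abs]
  exact lintegral_ball_rpow_le_morreyNormE hp _ z hr

/-- The averages of a Morrey function decay at a fixed rate in the radius. -/
lemma dyAvg_conjExp_le_morreyNorm {σ p κ : ℝ} (hσ : 0 < σ) (hσp : σ ≤ p) {f : Euc n → ℝ}
    (hf : Measurable f) (x : Euc n) (k : ℤ) :
    dyAvg (fun y => ‖f y‖ₑ ^ σ) x k ^ (1 / σ) ≤
      volume (ball x ((2 : ℝ) ^ k)) ^ ((κ - 1) * (1 / p)) * morreyNorm p κ f := by
  have hp : 0 < p := hσ.trans_le hσp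
  refine (dyAvg_rpow_le hσ hσp hf.enorm x k).trans ?_
  refine (ENNReal.rpow_le_rpow (dyAvg_le_rpow (lintegral_ball_enorm_rpow_le (κ := κ) hp f) x k)
    (by positivity)).trans (le_of_eq ?_)
  rw [ENNReal.mul_rpow_of_nonneg _ _ (by positivity), ← ENNReal.rpow_mul, ← ENNReal.rpow_mul,
    mul_one_div_cancel hp.ne', ENNReal.rpow_one]

lemma volume_ball_two_zpow (x : Euc n) (k : ℤ) :
    volume (ball x ((2 : ℝ) ^ k)) = 2 ^ ((k : ℝ) * n) * volume (ball (0 : Euc n) 1) := by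
  have hv := Measure.addHaar_ball_of_pos volume x (two_zpow_pos k)
  rwa [finrank_euclideanSpace_fin, ofReal_two_zpow_pow] at hv

/-- The product of the maximal functions controlling `multiT`. -/
def prodMax {m : ℕ} (σ : ℝ) (f : Fin m → Euc n → ℝ) (x : Euc n) : ℝ≥0∞ :=
  ∏ i, dyMax (fun y => ‖f i y‖ₑ ^ σ) x ^ (1 / σ)

/-- The constant in the pointwise estimate of `multiT`. -/
def pointConst {m : ℕ} (s : ℝ≥0∞) (α γ : ℝ) (Ω : Fin m → Euc n → ℝ) : ℝ≥0∞ :=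
  2 ^ (m * n - α) * (∏ i, kernelConst n s (Ω i)) * (2 ^ γ * geomSum (min α (γ - α)))

lemma pointConst_ne_top {m : ℕ} (hn : 0 < n) {s : ℝ≥0∞} (hs : 1 < s) {α γ : ℝ} (hα : 0 < α)
    (hγ : α < γ) {Ω : Fin m → Euc n → ℝ} (hΩ : ∀ i, MemSphereLp n s (Ω i)) :
    pointConst s α γ Ω ≠ ⊤ :=
  ENNReal.mul_ne_top (ENNReal.mul_ne_top (two_rpow_ne_top _)
    (ENNReal.prod_ne_top fun i _ => kernelConst_ne_top hn hs (hΩ i)))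
    (ENNReal.mul_ne_top (two_rpow_ne_top _)
      (geomSum_ne_top (lt_min hα (sub_pos.2 hγ))))

/-- Hedberg-type pointwise estimate of the multilinear fractional integral. -/
lemma enorm_multiT_le_prodMax {m : ℕ} {α : ℝ} (hα : 0 < α) (hαmn : α < m * n)
    {s : ℝ≥0∞} (hs : 1 < s) {Ω : Fin m → Euc n → ℝ} (hΩ : ∀ i, MemSphereLp n s (Ω i))
    {p : Fin m → ℝ} {P κ γ : ℝ} (hpi : ∀ i, conjExp s < p i) (hP : 1 / P = ∑ i, 1 / p i)
    (hγ : γ = n * (1 - κ) / P) (hαγ : α < γ) {f : Fin m → Euc n → ℝ}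
    (hf : ∀ i, Measurable (f i)) (hfin : ∀ i, morreyNorm (p i) κ (f i) < ⊤) (x : Euc n) :
    ‖multiT m α Ω f x‖ₑ ≤ pointConst s α γ Ω * (prodMax (conjExp s) f x ^ (1 - α / γ) *
      (volume (ball (0 : Euc n) 1) ^ ((κ - 1) / P) * ∏ i, morreyNorm (p i) κ (f i)) ^
        (α / γ)) := by
  have hσ : 0 < conjExp s := one_pos.trans_le (one_le_conjExp hs)
  have hb0 := volume_ball_ne_zero (0 : Euc n) one_pos
  have hbt := volume_ball_ne_top (0 : Euc n) 1
  set F := volume (ball (0 : Euc n) 1) ^ ((κ - 1) / P) * ∏ i, morreyNorm (p i) κ (f i) with hF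
  have hFt : F ≠ ⊤ := ENNReal.mul_ne_top (ENNReal.rpow_ne_top_of_ne_zero hb0 hbt)
    (ENNReal.prod_ne_top fun i _ => (hfin i).ne)
  set A : ℤ → ℝ≥0∞ := fun k => ∏ i, dyAvg (fun y => ‖f i y‖ₑ ^ conjExp s) x k ^ (1 / conjExp s)
    with hA
  have h1 : ∀ k, A k ≤ prodMax (conjExp s) f x := fun k =>
    Finset.prod_le_prod' fun i _ => ENNReal.rpow_le_rpow
      (le_iSup (dyAvg (fun y => ‖f i y‖ₑ ^ conjExp s) x) k) (by positivity)
  have h2 : ∀ k : ℤ, A k ≤ 2 ^ (-(k * γ)) * F := fun k => by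
    refine (Finset.prod_le_prod' fun i _ =>
      dyAvg_conjExp_le_morreyNorm (κ := κ) hσ (hpi i).le (hf i) x k).trans (le_of_eq ?_)
    rw [Finset.prod_mul_distrib, prod_rpow_eq_rpow_sum _ (volume_ball_ne_zero x (two_zpow_pos k))
      (volume_ball_ne_top x _), ← Finset.mul_sum, ← hP, mul_one_div, volume_ball_two_zpow,
      ENNReal.mul_rpow_of_ne_top (two_rpow_ne_top _) hbt, ← ENNReal.rpow_mul, hF, mul_assoc, hγ]
    congr 2
    ring
  have h3 : ∀ k : ℤ, (2 : ℝ≥0∞) ^ (-(k * (m * n - α))) *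
      ∏ i, ∫⁻ y in ball x ((2 : ℝ) ^ k), ‖Ω i (x - y) * f i y‖ₑ ≤
      (∏ i, kernelConst n s (Ω i)) * (2 ^ (k * α) * A k) := fun k => by
    refine (mul_le_mul_right (Finset.prod_le_prod' fun i _ =>
      lintegral_kernel_mul_le hs (hΩ i) (hf i) x k) _).trans (le_of_eq ?_)
    rw [Finset.prod_mul_distrib, Finset.prod_mul_distrib, Finset.prod_const, Finset.card_univ,
      Fintype.card_fin, ← ENNReal.rpow_natCast, ← ENNReal.rpow_mul, mul_left_comm, ← mul_assoc _ _ (A k),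
      ← two_rpow_add]
    congr 4
    ring
  calc ‖multiT m α Ω f x‖ₑ
      ≤ 2 ^ (m * n - α) * ∑' k : ℤ, (∏ i, kernelConst n s (Ω i)) * (2 ^ (k * α) * A k) :=
        (enorm_multiT_le hαmn (fun i => (hΩ i).1) hf x).trans
          (mul_le_mul_right (ENNReal.tsum_le_tsum h3) _)
    _ ≤ 2 ^ (m * n - α) * ((∏ i, kernelConst n s (Ω i)) *
        (2 ^ γ * geomSum (min α (γ - α)) *
          (prodMax (conjExp s) f x ^ (1 - α / γ) * F ^ (α / γ)))) := by
        rw [ENNReal.tsum_mul_left]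
        gcongr
        exact tsum_le_of_two_bounds hα hαγ hFt h1 h2
    _ = _ := by
        rw [pointConst]
        ring

/-- The constant in the Morrey estimate of `prodMax`. -/
def prodMaxConst (n : ℕ) {m : ℕ} (σ P κ : ℝ) (p : Fin m → ℝ) : ℝ≥0∞ :=
  ∏ i, (maxConst n (p i / σ) * (2 ^ n) ^ κ + 1) ^ (P / p i)

lemma prodMaxConst_ne_top (n : ℕ) {m : ℕ} {σ P κ : ℝ} (hσ : 0 < σ) (hP : 0 < P) (hκ : 0 ≤ κ)
    {p : Fin m → ℝ} (hp : ∀ i, σ < p i) : prodMaxConst n σ P κ p ≠ ⊤ := by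
  refine ENNReal.prod_ne_top fun i _ => ENNReal.rpow_ne_top_of_nonneg
    (div_nonneg hP.le (hσ.trans (hp i)).le) ?_
  have h := maxConst_ne_top n ((one_lt_div hσ).2 (hp i))
  have h2 : ((2 : ℝ≥0∞) ^ n) ^ κ ≠ ⊤ := ENNReal.rpow_ne_top_of_nonneg hκ (by finiteness)
  finiteness

lemma lintegral_ball_prodMax_rpow_le {m : ℕ} {σ P κ : ℝ} (hσ : 0 < σ) (hP0 : 0 < P) (hκ : κ ≤ 1)
    {p : Fin m → ℝ} (hp : ∀ i, σ < p i) (hP : 1 / P = ∑ i, 1 / p i)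
    {f : Fin m → Euc n → ℝ} (hf : ∀ i, Measurable (f i)) (z : Euc n) {r : ℝ} (hr : 0 < r) :
    ∫⁻ x in ball z r, prodMax σ f x ^ P ≤
      prodMaxConst n σ P κ p * (volume (ball z r) ^ κ * (∏ i, morreyNorm (p i) κ (f i)) ^ P) := by
  have hv0 := volume_ball_ne_zero z hr
  have hvt := volume_ball_ne_top z r
  have hp0 : ∀ i, 0 < p i := fun i => hσ.trans (hp i)
  have hsum : ∑ i, P / p i = 1 := by
    simp_rw [div_eq_mul_one_div P]
    rw [← Finset.mul_sum, ← hP, mul_one_div_cancel hP0.ne']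
  have hm : ∀ i, Measurable fun y => ‖f i y‖ₑ ^ σ := fun i => (hf i).enorm.pow_const _
  have e : ∀ x, prodMax σ f x ^ P =
      ∏ i, (dyMax (fun y => ‖f i y‖ₑ ^ σ) x ^ (p i / σ)) ^ (P / p i) := fun x => by
    rw [prodMax, ← ENNReal.prod_rpow_of_nonneg hP0.le]
    refine Finset.prod_congr rfl fun i _ => ?_
    rw [← ENNReal.rpow_mul, ← ENNReal.rpow_mul]
    congr 1
    have := (hp0 i).ne'
    field_simp
  simp_rw [e]
  refine (ENNReal.lintegral_prod_norm_pow_le _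
    (fun i _ => ((measurable_dyMax (hm i)).pow_const _).aemeasurable) hsum
    fun i _ => (div_pos hP0 (hp0 i)).le).trans ?_
  have hi : ∀ i, ∫⁻ x in ball z r, dyMax (fun y => ‖f i y‖ₑ ^ σ) x ^ (p i / σ) ≤
      (maxConst n (p i / σ) * (2 ^ n) ^ κ + 1) *
        (volume (ball z r) ^ κ * morreyNorm (p i) κ (f i) ^ p i) := fun i => by
    refine lintegral_ball_dyMax_rpow_le ((one_lt_div hσ).2 (hp i)) hκ (hm i)
      (fun z r hr => ?_) z hr
    simp_rw [← ENNReal.rpow_mul, mul_div_cancel₀ _ hσ.ne']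
    exact lintegral_ball_enorm_rpow_le (hp0 i) (f i) z r hr
  refine (Finset.prod_le_prod' fun i _ =>
    ENNReal.rpow_le_rpow (hi i) (div_pos hP0 (hp0 i)).le).trans (le_of_eq ?_)
  have hexp : ∀ i, ((maxConst n (p i / σ) * (2 ^ n) ^ κ + 1) *
      (volume (ball z r) ^ κ * morreyNorm (p i) κ (f i) ^ p i)) ^ (P / p i) =
      (maxConst n (p i / σ) * (2 ^ n) ^ κ + 1) ^ (P / p i) *
        ((volume (ball z r) ^ κ) ^ (P / p i) * morreyNorm (p i) κ (f i) ^ P) := fun i => by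
    have h0 := (div_pos hP0 (hp0 i)).le
    rw [ENNReal.mul_rpow_of_nonneg _ _ h0, ENNReal.mul_rpow_of_nonneg _ _ h0,
      ← ENNReal.rpow_mul (morreyNorm _ _ _), mul_div_cancel₀ _ (hp0 i).ne']
  rw [Finset.prod_congr rfl fun i _ => hexp i, Finset.prod_mul_distrib, Finset.prod_mul_distrib,
    prod_rpow_eq_rpow_sum _ ((ENNReal.rpow_pos (pos_iff_ne_zero.2 hv0) hvt).ne')
      (ENNReal.rpow_ne_top_of_ne_zero hv0 hvt), hsum, ENNReal.rpow_one,
    ENNReal.prod_rpow_of_nonneg hP0.le, prodMaxConst]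

end Auxiliary

/-- Strong type boundedness of the multilinear fractional integral operator with
homogeneous kernels on Morrey spaces (Adams-type result). -/
theorem stmt10
    (n m : ℕ) (hn : 2 ≤ n) (hm : 1 ≤ m) (α : ℝ) (hα : 0 < α) (hαmn : α < m * n)
    (s : ℝ≥0∞) (hs : 1 < s) (Ω : Fin m → Euc n → ℝ) (hΩ : ∀ i, MemSphereLp n s (Ω i))
    (p : Fin m → ℝ) (P q κ : ℝ)
    (hpi : ∀ i, conjExp s < p i)
    (hP : 1 / P = ∑ i, 1 / p i)
    (hPlow : conjExp s / m < P) (hPhigh : P < n / α)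
    (hκ0 : 0 < κ) (hκ1 : κ < 1 - α * P / n)
    (hq : 1 / q = 1 / P - α / (n * (1 - κ))) :
    ∃ C : ℝ, 0 < C ∧ ∀ f : Fin m → Euc n → ℝ,
      (∀ i, Measurable (f i)) → (∀ i, morreyNorm (p i) κ (f i) < ⊤) →
      morreyNorm q κ (multiT m α Ω f) ≤
        ENNReal.ofReal C * ∏ i, morreyNorm (p i) κ (f i) := by
  have hn0 : 0 < n := by omega
  have hnr : (0 : ℝ) < n := by exact_mod_cast hn0
  have hmr : (0 : ℝ) < m := by exact_mod_cast hm
  have hσ : 0 < conjExp s := one_pos.trans_le (one_le_conjExp hs)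
  have hP0 : 0 < P := (div_pos hσ hmr).trans hPlow
  have hκ : 0 < 1 - κ := by
    have : 0 < α * P / n := by positivity
    linarith
  obtain ⟨γ, hγ⟩ : ∃ γ : ℝ, γ = n * (1 - κ) / P := ⟨_, rfl⟩
  have hαγ : α < γ := by
    have h1 : α * P / n < 1 - κ := by linarith
    rw [div_lt_iff₀ hnr] at h1
    rw [hγ, lt_div_iff₀ hP0]
    linarith
  have hγ0 : 0 < γ := hα.trans hαγ
  have hθ : α / γ < 1 := (div_lt_one hγ0).2 hαγ
  have hqP : 1 / q = (1 - α / γ) / P := by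
    rw [hq, hγ]
    field_simp
  have hq0 : 0 < q := one_div_pos.1 (hqP ▸ div_pos (by linarith) hP0)
  have hexp : (1 - α / γ) * q = P := by
    rw [div_eq_div_iff hq0.ne' hP0.ne'] at hqP
    linarith
  obtain ⟨C₀, hC₀⟩ : ∃ C₀ : ℝ≥0∞, C₀ = pointConst s α γ Ω ^ q *
      (volume (ball (0 : Euc n) 1) ^ ((κ - 1) / P)) ^ (α / γ * q) *
      prodMaxConst n (conjExp s) P κ p := ⟨_, rfl⟩
  have hθq : 0 ≤ α / γ * q := by positivity
  have hKq : pointConst s α γ Ω ^ q ≠ ⊤ :=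
    ENNReal.rpow_ne_top_of_nonneg hq0.le (pointConst_ne_top hn0 hs hα hαγ hΩ)
  have hv : volume (ball (0 : Euc n) 1) ^ ((κ - 1) / P) ≠ ⊤ :=
    ENNReal.rpow_ne_top_of_ne_zero (volume_ball_ne_zero _ one_pos) (volume_ball_ne_top _ _)
  have hC₀t : C₀ ≠ ⊤ := by
    rw [hC₀]
    exact ENNReal.mul_ne_top (ENNReal.mul_ne_top hKq (ENNReal.rpow_ne_top_of_nonneg hθq hv))
      (prodMaxConst_ne_top n hσ hP0 hκ0.le hpi)
  have hCt : C₀ ^ (1 / q) ≠ ⊤ := ENNReal.rpow_ne_top_of_nonneg (by positivity) hC₀t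
  refine ⟨(C₀ ^ (1 / q)).toReal + 1, by positivity, fun f hf hfin => ?_⟩
  have hCle : C₀ ^ (1 / q) ≤ ENNReal.ofReal ((C₀ ^ (1 / q)).toReal + 1) := by
    rw [← ENNReal.ofReal_toReal hCt, ENNReal.toReal_ofReal ENNReal.toReal_nonneg]
    exact ENNReal.ofReal_le_ofReal (by linarith)
  refine le_trans (iSup₂_le fun z r => ?_) (mul_le_mul_left hCle _)
  obtain ⟨r, hr⟩ := r
  have hr : 0 < r := hr
  have hV0 := volume_ball_ne_zero z hr
  have hVt := volume_ball_ne_top z r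
  set F := ∏ i, morreyNorm (p i) κ (f i) with hF
  have hFt : F ≠ ⊤ := ENNReal.prod_ne_top fun i _ => (hfin i).ne
  set v := volume (ball (0 : Euc n) 1) ^ ((κ - 1) / P)
  have hpt : ∀ x, ENNReal.ofReal |multiT m α Ω f x| ^ q ≤
      pointConst s α γ Ω ^ q * (v * F) ^ (α / γ * q) * prodMax (conjExp s) f x ^ P := fun x => by
    rw [← Real.enorm_eq_ofReal_abs]
    refine (ENNReal.rpow_le_rpow (enorm_multiT_le_prodMax hα hαmn hs hΩ hpi hP hγ hαγ hf hfin x)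
      hq0.le).trans (le_of_eq ?_)
    rw [ENNReal.mul_rpow_of_nonneg _ _ hq0.le, ENNReal.mul_rpow_of_nonneg _ _ hq0.le,
      ← ENNReal.rpow_mul, ← ENNReal.rpow_mul, hexp]
    ring
  have hct : pointConst s α γ Ω ^ q * (v * F) ^ (α / γ * q) ≠ ⊤ :=
    ENNReal.mul_ne_top hKq (ENNReal.rpow_ne_top_of_nonneg hθq (ENNReal.mul_ne_top hv hFt))
  have hint : ∫⁻ x in ball z r, ENNReal.ofReal |multiT m α Ω f x| ^ q ≤
      volume (ball z r) ^ κ * (C₀ * F ^ q) := by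
    refine (lintegral_mono hpt).trans ?_
    rw [lintegral_const_mul' _ _ hct]
    refine (mul_le_mul_right (lintegral_ball_prodMax_rpow_le hσ hP0 (sub_nonneg.1 hκ.le) hpi hP hf z hr)
      _).trans (le_of_eq ?_)
    have hFq : F ^ q = F ^ (α / γ * q) * F ^ P := by
      rw [← ENNReal.rpow_add_of_nonneg _ _ hθq hP0.le]
      congr 1
      linarith
    rw [hFq, hC₀, ENNReal.mul_rpow_of_nonneg _ _ hθq]
    ring
  refine (ENNReal.rpow_le_rpow (mul_le_mul_right hint _) (by positivity)).trans (le_of_eq ?_)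
  rw [← mul_assoc, ← ENNReal.rpow_add _ _ hV0 hVt, neg_add_cancel, ENNReal.rpow_zero, one_mul,
    ENNReal.mul_rpow_of_nonneg _ _ (by positivity), ← ENNReal.rpow_mul,
    mul_one_div_cancel hq0.ne', ENNReal.rpow_one]

end
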